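/- For $a>1$ and $j\in\mathbb{N}$ let $\xi_j^{a,0}\in L_2(0,1)$ be the 1-periodic function with Fourier coefficients $\widehat{\xi}_j^{a,0}(k)=\exp\big(-\tfrac{k^2+a^2}{ja}\big)$. Then $\lim_{j\to\infty}\sup_{a>1}UC(\xi_j^{a,0})=\tfrac12$ and $\lim_{a\to\infty}\sup_{j\in\mathbb{N}}UC(\xi_j^{a,0})=\tfrac12$. -/

import Mathlib

open Filter

noncomputable section

/-- The sum `∑ₖ cₖ · conj c_{k+1}` appearing in the first trigonometric moment. -/
def trigSum (c : ℤ → ℂ) : ℂ := ∑' k : ℤ, c k * (starRingEnd ℂ) (c (k + 1))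

/-- The first trigonometric moment `τ(f) = -2π ∑ₖ cₖ · conj c_{k+1}`. -/
def tau (c : ℤ → ℂ) : ℂ := -2 * Real.pi * trigSum c

/-- The angular variance of a 1-periodic function given by its Fourier coefficients. -/
def varA (c : ℤ → ℂ) : ℝ :=
  (1 / (4 * Real.pi ^ 2)) *
    ((∑' k : ℤ, ‖c k‖ ^ 2) ^ 2 / ‖trigSum c‖ ^ 2 - 1)

/-- The frequency variance of a 1-periodic function given by its Fourier coefficients. -/
def varF (c : ℤ → ℂ) : ℝ :=
  (4 * Real.pi ^ 2 * ∑' k : ℤ, (k : ℝ) ^ 2 * ‖c k‖ ^ 2) / (∑' k : ℤ, ‖c k‖ ^ 2) -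
    (4 * Real.pi ^ 2 * (∑' k : ℤ, (k : ℝ) * ‖c k‖ ^ 2) ^ 2) /
      (∑' k : ℤ, ‖c k‖ ^ 2) ^ 2

/-- The Breitenberger (periodic) uncertainty constant. -/
def UC (c : ℤ → ℂ) : ℝ := Real.sqrt (varA c * varF c)

open Topology

/-- The theta series. -/
def th (t : ℝ) : ℝ := ∑' k : ℤ, Real.exp (-t * (k:ℝ) ^ 2)

/-- The second moment series. -/
def mom (t : ℝ) : ℝ := ∑' k : ℤ, (k:ℝ) ^ 2 * Real.exp (-t * (k:ℝ) ^ 2)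

/-- The half-integer theta series. -/
def hth (t : ℝ) : ℝ := ∑' k : ℤ, Real.exp (-t * ((k:ℝ) + 1 / 2) ^ 2)

lemma summ_mom {t : ℝ} (ht : 0 < t) :
    Summable fun k : ℤ => (k:ℝ) ^ 2 * Real.exp (-t * (k:ℝ) ^ 2) := by
  have h := summable_pow_mul_jacobiTheta₂_term_bound 0 (div_pos ht Real.pi_pos) 2
  refine h.congr fun k => ?_
  have : -Real.pi * (t / Real.pi * (k:ℝ) ^ 2 - 2 * 0 * |(k:ℝ)|) = -t * (k:ℝ) ^ 2 := by
    field_simp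
    ring
  simp only [Int.cast_abs, sq_abs] at *
  rw [← this]

lemma summ_th {t : ℝ} (ht : 0 < t) :
    Summable fun k : ℤ => Real.exp (-t * (k:ℝ) ^ 2) := by
  have h := summable_pow_mul_jacobiTheta₂_term_bound 0 (div_pos ht Real.pi_pos) 0
  refine h.congr fun k => ?_
  have : -Real.pi * (t / Real.pi * (k:ℝ) ^ 2 - 2 * 0 * |(k:ℝ)|) = -t * (k:ℝ) ^ 2 := by
    field_simp
    ring
  simp only [Int.cast_abs, pow_zero, one_mul] at *
  rw [← this]

lemma th_ge_one {t : ℝ} (ht : 0 < t) : 1 ≤ th t := by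
  have := (summ_th ht).le_tsum 0 (fun j _ => (Real.exp_pos _).le)
  simpa [th] using this

lemma th_le {u : ℝ} (hu : 1 ≤ u) : th u ≤ 1 + Real.exp (1 - u) * th 1 := by
  have h1 : HasSum (fun k : ℤ => if k = 0 then (1:ℝ) else 0) 1 := hasSum_ite_eq 0 1
  have h2 := (summ_th one_pos).hasSum.mul_left (Real.exp (1 - u))
  refine hasSum_le (fun k => ?_) (summ_th (by linarith)).hasSum (h1.add h2)
  by_cases hk : k = 0
  · subst hk
    simp [(Real.exp_pos _).le]
  · simp only [hk, if_false, zero_add, ← Real.exp_add]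
    have : (1:ℝ) ≤ (k:ℝ) ^ 2 := by
      have : 0 < k ^ 2 := by positivity
      exact_mod_cast this
    apply Real.exp_le_exp.2
    nlinarith

lemma th_fun {t : ℝ} (ht : 0 < t) :
    th t = Real.sqrt (Real.pi / t) * th (Real.pi ^ 2 / t) := by
  have h := Real.tsum_exp_neg_mul_int_sq (div_pos ht Real.pi_pos)
  have e1 : -Real.pi * (t / Real.pi) = -t := by field_simp
  have e2 : -Real.pi / (t / Real.pi) = -(Real.pi ^ 2 / t) := by field_simp
  rw [e1, e2, ← Real.sqrt_eq_rpow] at h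
  rw [th, h, th, one_div, ← Real.sqrt_inv, inv_div]

lemma th_lim : Tendsto (fun u => u * (th u - 1)) atTop (𝓝 0) := by
  have h : Tendsto (fun u : ℝ => (u ^ 1 * Real.exp (-u)) * (Real.exp 1 * th 1)) atTop (𝓝 0) := by
    simpa using (Real.tendsto_pow_mul_exp_neg_atTop_nhds_zero 1).mul_const (Real.exp 1 * th 1)
  refine squeeze_zero' ?_ ?_ h
  · filter_upwards [eventually_ge_atTop 1] with u hu
    have := th_ge_one (show 0 < u by linarith)
    exact mul_nonneg (by linarith) (by linarith)
  · filter_upwards [eventually_ge_atTop 1] with u hu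
    have := th_le hu
    rw [sub_eq_add_neg, Real.exp_add] at this
    nlinarith

lemma th_lim1 : Tendsto th atTop (𝓝 1) := by
  have h : Tendsto (fun u : ℝ => u⁻¹ * (u * (th u - 1)) + 1) atTop (𝓝 1) := by
    simpa using (tendsto_inv_atTop_zero.mul th_lim).add_const 1
  refine h.congr' ?_
  filter_upwards [eventually_gt_atTop 0] with u hu
  field_simp
  ring

lemma inv_lim {c : ℝ} (hc : 0 < c) : Tendsto (fun t : ℝ => c / t) (𝓝[>] 0) atTop := by
  simpa [div_eq_mul_inv] using (tendsto_inv_nhdsGT_zero (𝕜 := ℝ)).const_mul_atTop hc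

lemma ratio_lim {q : ℝ} (hq : 0 < q) :
    Tendsto (fun t => th (t / q ^ 2) / th t) (𝓝[>] 0) (𝓝 q) := by
  have h1 := th_lim1.comp (inv_lim (c := Real.pi ^ 2 * q ^ 2) (by positivity))
  have h2 := th_lim1.comp (inv_lim (c := Real.pi ^ 2) (by positivity))
  have h3 := (h1.div h2 one_ne_zero).const_mul q
  simp only [div_one, mul_one] at h3
  refine h3.congr' ?_
  filter_upwards [self_mem_nhdsWithin] with t ht
  have ht : 0 < t := ht
  simp only [Function.comp, Pi.div_apply]
  rw [th_fun ht, th_fun (show 0 < t / q ^ 2 by positivity)]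
  have e1 : Real.pi / (t / q ^ 2) = q ^ 2 * (Real.pi / t) := by field_simp
  have e2 : Real.pi ^ 2 / (t / q ^ 2) = Real.pi ^ 2 * q ^ 2 / t := by field_simp
  rw [e1, e2, Real.sqrt_mul (by positivity), Real.sqrt_sq hq.le]
  have p1 : 0 < Real.sqrt (Real.pi / t) := Real.sqrt_pos.2 (div_pos Real.pi_pos ht)
  have p2 := th_ge_one (show 0 < Real.pi ^ 2 / t by positivity)
  field_simp

lemma mom_ineq {s t : ℝ} (hs : 0 < s) (ht : 0 < t) : (t - s) * mom t ≤ th s - th t := by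
  refine hasSum_le (fun k => ?_) ((summ_mom ht).hasSum.mul_left (t - s))
    ((summ_th hs).hasSum.sub (summ_th ht).hasSum)
  have e : Real.exp (-s * (k:ℝ) ^ 2) =
      Real.exp ((t - s) * (k:ℝ) ^ 2) * Real.exp (-t * (k:ℝ) ^ 2) := by
    rw [← Real.exp_add]; ring_nf
  have := Real.add_one_le_exp ((t - s) * (k:ℝ) ^ 2)
  have := Real.exp_pos (-t * (k:ℝ) ^ 2)
  rw [e]
  nlinarith

lemma mom_ineq' {q t : ℝ} (hq : 0 < q) (ht : 0 < t) :
    (q ^ 2 - 1) * (t * mom t / th t) ≤ q ^ 2 * (th (t / q ^ 2) / th t - 1) := by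
  have h := mom_ineq (show 0 < t / q ^ 2 by positivity) ht
  have p := th_ge_one ht
  have p' : 0 < th t := by linarith
  have e : (q ^ 2 - 1) * (t * mom t / th t) = q ^ 2 * (((t - t / q ^ 2) * mom t) / th t) := by
    field_simp
  have e' : th (t / q ^ 2) / th t - 1 = (th (t / q ^ 2) - th t) / th t := by
    field_simp
  rw [e, e']
  gcongr

lemma mom_lim : Tendsto (fun t => t * mom t / th t) (𝓝[>] 0) (𝓝 (1 / 2)) := by
  have hc : Tendsto (fun q : ℝ => q ^ 2 / (q + 1)) (𝓝 1) (𝓝 (1 / 2)) := by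
    have : ContinuousAt (fun q : ℝ => q ^ 2 / (q + 1)) 1 := by
      apply ContinuousAt.div <;> first | fun_prop | norm_num
    have h := this.tendsto
    norm_num at h ⊢
    exact h
  have key : ∀ q : ℝ, 0 < q → Tendsto (fun t => q ^ 2 * (th (t / q ^ 2) / th t - 1))
      (𝓝[>] 0) (𝓝 (q ^ 2 * (q - 1))) :=
    fun q hq => ((ratio_lim hq).sub_const 1).const_mul _
  rw [tendsto_order]
  constructor
  · intro b hb
    have h1 : ∀ᶠ q in 𝓝[<] (1:ℝ), b < q ^ 2 / (q + 1) :=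
      (hc.mono_left nhdsWithin_le_nhds).eventually (lt_mem_nhds hb)
    have h2 : ∀ᶠ q in 𝓝[<] (1:ℝ), 0 < q :=
      nhdsWithin_le_nhds (lt_mem_nhds one_pos)
    obtain ⟨q, hq1, hq2, hq3⟩ := (h1.and (h2.and self_mem_nhdsWithin)).exists
    have hq3 : q < 1 := hq3
    have hb' : q ^ 2 * (q - 1) < (q ^ 2 - 1) * b := by
      rw [lt_div_iff₀ (by linarith)] at hq1
      nlinarith
    filter_upwards [(key q hq2).eventually (gt_mem_nhds hb'), self_mem_nhdsWithin] with t h ht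
    have := mom_ineq' hq2 ht
    have h3 : q ^ 2 - 1 < 0 := by nlinarith
    nlinarith
  · intro b hb
    have h1 : ∀ᶠ q in 𝓝[>] (1:ℝ), q ^ 2 / (q + 1) < b :=
      (hc.mono_left nhdsWithin_le_nhds).eventually (gt_mem_nhds hb)
    obtain ⟨q, hq1, hq3⟩ := (h1.and self_mem_nhdsWithin).exists
    have hq3 : 1 < q := hq3
    have hb' : q ^ 2 * (q - 1) < (q ^ 2 - 1) * b := by
      rw [div_lt_iff₀ (by linarith)] at hq1
      nlinarith
    have hq2 : 0 < q := by linarith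
    filter_upwards [(key q hq2).eventually (gt_mem_nhds hb'), self_mem_nhdsWithin] with t h ht
    have := mom_ineq' hq2 ht
    have h3 : 0 < q ^ 2 - 1 := by nlinarith
    nlinarith

lemma hth_eq {t : ℝ} (ht : 0 < t) : hth t = th (t / 4) - th t := by
  have hs := summ_th (show 0 < t / 4 by positivity)
  have i0 : Function.Injective (fun k : ℤ => 2 * k) := fun a b h => by simpa using h
  have i1 : Function.Injective (fun k : ℤ => 2 * k + 1) := fun a b h => by simpa using h
  have s0 := (hs.comp_injective i0).hasSum
  have s1 := (hs.comp_injective i1).hasSum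
  have hc : IsCompl (Set.range (fun k : ℤ => 2 * k)) (Set.range (fun k : ℤ => 2 * k + 1)) := by
    have q0 : Set.range (fun k : ℤ => 2 * k) = {n : ℤ | Even n} := by
      ext n
      constructor
      · rintro ⟨k, rfl⟩
        exact even_two_mul k
      · rintro ⟨k, rfl⟩
        exact ⟨k, two_mul k⟩
    have q1 : Set.range (fun k : ℤ => 2 * k + 1) = {n : ℤ | Odd n} := by
      ext n
      constructor
      · rintro ⟨k, rfl⟩
        exact ⟨k, rfl⟩
      · rintro ⟨k, rfl⟩
        exact ⟨k, rfl⟩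
    rw [q0, q1]
    exact Int.isCompl_even_odd
  have h := (HasSum.add_isCompl hc (i0.hasSum_range_iff.2 s0) (i1.hasSum_range_iff.2 s1)).tsum_eq
  have e0 : ((fun k : ℤ => Real.exp (-(t / 4) * (k:ℝ) ^ 2)) ∘ fun k : ℤ => 2 * k) =
      fun k : ℤ => Real.exp (-t * (k:ℝ) ^ 2) := by
    funext k; simp only [Function.comp]; push_cast; ring_nf
  have e1 : ((fun k : ℤ => Real.exp (-(t / 4) * (k:ℝ) ^ 2)) ∘ fun k : ℤ => 2 * k + 1) =
      fun k : ℤ => Real.exp (-t * ((k:ℝ) + 1 / 2) ^ 2) := by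
    funext k; simp only [Function.comp]; push_cast; ring_nf
  rw [e0, e1] at h
  rw [th, th, hth, h]
  ring

lemma hth_fun {t : ℝ} (ht : 0 < t) : hth t = Real.sqrt (Real.pi / t) *
    (2 * th (4 * (Real.pi ^ 2 / t)) - th (Real.pi ^ 2 / t)) := by
  rw [hth_eq ht, th_fun ht, th_fun (show 0 < t / 4 by positivity)]
  have e1 : Real.pi / (t / 4) = 2 ^ 2 * (Real.pi / t) := by field_simp; norm_num
  have e2 : Real.pi ^ 2 / (t / 4) = 4 * (Real.pi ^ 2 / t) := by field_simp
  rw [e1, e2, Real.sqrt_mul (by positivity), Real.sqrt_sq (by norm_num)]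
  ring

lemma quot_lim : Tendsto (fun u => th u / (2 * th (4 * u) - th u)) atTop (𝓝 1) := by
  have h4 : Tendsto (fun u : ℝ => 4 * u) atTop atTop :=
    tendsto_id.const_mul_atTop (by norm_num)
  have h := th_lim1.div (((th_lim1.comp h4).const_mul 2).sub th_lim1) (by norm_num)
  norm_num at h
  exact h

lemma quot_lim2 : Tendsto (fun u => u * ((th u / (2 * th (4 * u) - th u)) ^ 2 - 1))
    atTop (𝓝 0) := by
  have h4 : Tendsto (fun u : ℝ => 4 * u) atTop atTop :=
    tendsto_id.const_mul_atTop (by norm_num)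
  have hd : Tendsto (fun u => 2 * th (4 * u) - th u) atTop (𝓝 1) := by
    have := ((th_lim1.comp h4).const_mul 2).sub th_lim1
    norm_num at this
    exact this
  have h1 : Tendsto (fun u => 2 * (u * (th u - 1)) - (1 / 2) * (4 * u * (th (4 * u) - 1)))
      atTop (𝓝 0) := by
    have := (th_lim.const_mul 2).sub ((th_lim.comp h4).const_mul (1 / 2))
    rw [mul_zero, mul_zero, sub_zero] at this
    exact this
  have h2 := (h1.div hd one_ne_zero).mul (quot_lim.add_const 1)
  simp only [zero_div, zero_mul] at h2
  refine h2.congr' ?_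
  filter_upwards [hd.eventually (lt_mem_nhds one_pos)] with u hu
  simp only [Pi.div_apply]
  obtain ⟨D, hD⟩ : ∃ D, D = 2 * th (4 * u) - th u := ⟨_, rfl⟩
  have hB : th (4 * u) = (D + th u) / 2 := by rw [hD]; ring
  rw [← hD] at hu ⊢
  rw [hB]
  field_simp
  ring

lemma exp_lim : Tendsto (fun t : ℝ => (Real.exp (t / 2) - 1) / t) (𝓝[>] 0) (𝓝 (1 / 2)) := by
  have h : HasDerivAt (fun t : ℝ => Real.exp (t / 2)) (1 / 2) 0 := by
    have := ((hasDerivAt_id (0:ℝ)).div_const 2).exp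
    simpa using this
  have h2 := (hasDerivAt_iff_tendsto_slope.1 h).mono_left
    (nhdsWithin_mono 0 (fun x (hx : 0 < x) => hx.ne'))
  refine h2.congr fun t => ?_
  simp [slope_def_field]

/-- The squared uncertainty constant, as a function of `t`. -/
def ucs (t : ℝ) : ℝ := ((th t / (Real.exp (-(t / 4)) * hth t)) ^ 2 - 1) * (mom t / th t)

lemma ucs_lim : Tendsto ucs (𝓝[>] 0) (𝓝 (1 / 4)) := by
  have hu := inv_lim (c := Real.pi ^ 2) (by positivity)
  have h1 := (quot_lim2.comp hu).const_mul (1 / Real.pi ^ 2)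
  have he : Tendsto (fun t : ℝ => Real.exp (t / 2)) (𝓝[>] 0) (𝓝 1) := by
    have : ContinuousAt (fun t : ℝ => Real.exp (t / 2)) 0 := by fun_prop
    simpa using this.tendsto.mono_left nhdsWithin_le_nhds
  have h := (exp_lim.add (he.mul h1)).mul mom_lim
  norm_num at h
  refine h.congr' ?_
  filter_upwards [self_mem_nhdsWithin] with t ht
  have ht : 0 < t := ht
  have p1 : 0 < Real.sqrt (Real.pi / t) := Real.sqrt_pos.2 (div_pos Real.pi_pos ht)
  have e : th t / (Real.exp (-(t / 4)) * hth t) =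
      Real.exp (t / 4) * (th (Real.pi ^ 2 / t) /
        (2 * th (4 * (Real.pi ^ 2 / t)) - th (Real.pi ^ 2 / t))) := by
    rw [hth_fun ht, th_fun ht, Real.exp_neg]
    rw [mul_left_comm, mul_div_mul_left _ _ p1.ne', div_eq_mul_inv, mul_inv, inv_inv]
    ring
  have e2 : Real.exp (t / 2) = Real.exp (t / 4) ^ 2 := by
    rw [← Real.exp_nat_mul]; ring_nf
  rw [ucs, e, mul_pow, ← e2]
  generalize th (Real.pi ^ 2 / t) /
        (2 * th (4 * (Real.pi ^ 2 / t)) - th (Real.pi ^ 2 / t)) = Q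
  have := th_ge_one ht
  have : th t ≠ 0 := by linarith
  field_simp
  ring

lemma UC_eq (j : ℕ) (hj : 0 < j) (a : ℝ) (ha : 0 < a) :
    UC (fun k : ℤ => ((Real.exp (-(((k:ℝ) ^ 2 + a ^ 2) / ((j:ℝ) * a))) : ℝ) : ℂ)) =
      Real.sqrt (ucs (2 / (j * a))) := by
  have hj' : (0:ℝ) < j := by exact_mod_cast hj
  set t : ℝ := 2 / (j * a) with htd
  have ht : 0 < t := by positivity
  set K : ℝ := Real.exp (-(2 * a / j)) with hK
  have hK0 : 0 < K := Real.exp_pos _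
  have n1 : ∀ k : ℤ, ‖((Real.exp (-(((k:ℝ) ^ 2 + a ^ 2) / ((j:ℝ) * a))) : ℝ) : ℂ)‖ ^ 2 =
      K * Real.exp (-t * (k:ℝ) ^ 2) := by
    intro k
    rw [Complex.norm_real, Real.norm_eq_abs, Real.abs_exp, ← Real.exp_nat_mul, hK,
      ← Real.exp_add, htd]
    congr 1
    field_simp
    push_cast
    ring
  have n2 : ∀ k : ℤ, ((Real.exp (-(((k:ℝ) ^ 2 + a ^ 2) / ((j:ℝ) * a))) : ℝ) : ℂ) *
      (starRingEnd ℂ) ((Real.exp (-((((k + 1 : ℤ):ℝ) ^ 2 + a ^ 2) / ((j:ℝ) * a))) : ℝ) : ℂ) =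
      ((K * Real.exp (-(t / 4)) * Real.exp (-t * ((k:ℝ) + 1 / 2) ^ 2) : ℝ) : ℂ) := by
    intro k
    rw [Complex.conj_ofReal, ← Complex.ofReal_mul, ← Real.exp_add, hK, ← Real.exp_add,
      ← Real.exp_add, htd]
    congr 2
    push_cast
    field_simp
    ring
  have z : ∑' k : ℤ, (k:ℝ) * (K * Real.exp (-t * (k:ℝ) ^ 2)) = 0 := by
    have h := (Equiv.neg ℤ).tsum_eq (fun k : ℤ => (k:ℝ) * (K * Real.exp (-t * (k:ℝ) ^ 2)))
    simp only [Equiv.neg_apply, Int.cast_neg, even_two.neg_pow, neg_mul, tsum_neg] at h ⊢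
    linarith
  have m : ∑' k : ℤ, (k:ℝ) ^ 2 * (K * Real.exp (-t * (k:ℝ) ^ 2)) = K * mom t := by
    rw [mom, ← tsum_mul_left]
    congr 1; funext k; ring
  have s : ∑' k : ℤ, K * Real.exp (-t * (k:ℝ) ^ 2) = K * th t := by
    rw [th, ← tsum_mul_left]
  have tr : ‖trigSum (fun k : ℤ =>
      ((Real.exp (-(((k:ℝ) ^ 2 + a ^ 2) / ((j:ℝ) * a))) : ℝ) : ℂ))‖ ^ 2 =
      (K * Real.exp (-(t / 4)) * hth t) ^ 2 := by
    rw [trigSum]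
    simp only [n2]
    rw [← Complex.ofReal_tsum, tsum_mul_left, Complex.norm_real, Real.norm_eq_abs, sq_abs, hth]
  rw [UC, varA, varF, tr]
  simp only [n1, z, m, s]
  congr 1
  have := th_ge_one ht
  have h0 : th t ≠ 0 := by linarith
  have e : (K * th t) ^ 2 / (K * Real.exp (-(t / 4)) * hth t) ^ 2 =
      (th t / (Real.exp (-(t / 4)) * hth t)) ^ 2 := by
    rw [← div_pow, mul_assoc, mul_div_mul_left _ _ hK0.ne']
  rw [e, ucs]
  generalize (th t / (Real.exp (-(t / 4)) * hth t)) ^ 2 = Q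
  have := Real.pi_pos
  field_simp
  ring

lemma uc_eps (ε : ℝ) (hε : 0 < ε) : ∃ δ > 0, ∀ t : ℝ, 0 < t → t < δ →
    |Real.sqrt (ucs t) - 1 / 2| < ε := by
  have h : Tendsto (fun t => Real.sqrt (ucs t)) (𝓝[>] 0) (𝓝 (1 / 2)) := by
    have := (Real.continuous_sqrt.tendsto _).comp ucs_lim
    rwa [show (1 / 4 : ℝ) = (1 / 2) ^ 2 by norm_num, Real.sqrt_sq (by norm_num)] at this
  obtain ⟨δ, hδ, H⟩ := (Metric.tendsto_nhdsWithin_nhds.1 h) ε hε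
  refine ⟨δ, hδ, fun t h0 h1 => ?_⟩
  have := H (x := t) h0 (by simpa [abs_of_pos h0] using h1)
  rwa [Real.dist_eq] at this


/-- `lim_{j→∞} sup_{a>1} UC(ξ_j^{a,0}) = 1/2` and `lim_{a→∞} sup_{j∈ℕ} UC(ξ_j^{a,0}) = 1/2`
for the functions with Fourier coefficients `ξ̂_j^{a,0}(k) = exp(-(k²+a²)/(ja))`,
stated as uniform limits. -/
theorem UC_xi0_uniform_limits :
    (∀ ε > 0, ∃ J : ℕ, ∀ j : ℕ, J ≤ j → ∀ a : ℝ, 1 < a →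
        |UC (fun k : ℤ => ((Real.exp (-(((k:ℝ) ^ 2 + a ^ 2) / ((j:ℝ) * a))) : ℝ) : ℂ)) - 1 / 2| < ε) ∧
      (∀ ε > 0, ∃ A : ℝ, ∀ a : ℝ, A ≤ a → ∀ j : ℕ, 1 ≤ j →
        |UC (fun k : ℤ => ((Real.exp (-(((k:ℝ) ^ 2 + a ^ 2) / ((j:ℝ) * a))) : ℝ) : ℂ)) - 1 / 2| < ε) := by
  constructor
  · intro ε hε
    obtain ⟨δ, hδ, H⟩ := uc_eps ε hε
    obtain ⟨J, hJ⟩ := exists_nat_gt (2 / δ)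
    refine ⟨J, fun j hj a ha => ?_⟩
    have h1 : (J:ℝ) ≤ j := by exact_mod_cast hj
    have h0 : 0 < 2 / δ := by positivity
    have hj0 : (0:ℝ) < j := by linarith
    rw [UC_eq j (by exact_mod_cast hj0) a (by linarith)]
    refine H _ (by positivity) ?_
    rw [div_lt_iff₀ hδ] at hJ
    rw [div_lt_iff₀ (by positivity)]
    nlinarith [mul_pos hδ hj0]
  · intro ε hε
    obtain ⟨δ, hδ, H⟩ := uc_eps ε hε
    refine ⟨2 / δ + 1, fun a ha j hj => ?_⟩
    have h1 : (1:ℝ) ≤ j := by exact_mod_cast hj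
    have h0 : 0 < 2 / δ := by positivity
    have ha0 : 0 < a := by linarith
    rw [UC_eq j hj a ha0]
    refine H _ (by positivity) ?_
    have hJ : 2 / δ < a := by linarith
    rw [div_lt_iff₀ hδ] at hJ
    rw [div_lt_iff₀ (by positivity)]
    nlinarith [mul_pos hδ ha0]
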